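/- arXiv:1507.01258 — 2 statements merged into one kernel-verified Lean document; each statement's English description precedes it below -/
import Mathlib

section
/- Let W = e^{−Q} ∈ F(C²) with Q even, and suppose the function T(t) = tQ'(t)/Q(t) satisfies lim_{x→∞} T(x) = α for some α ∈ (1, ∞). Then lim_{n→∞} n/(a_n Q'(a_n)) = B_α, where B_α = (2/π) ∫₀¹ t^α/√(1−t²) dt and a_n is the Mhaskar–Rakhmanov–Saff number. In particular, there is a constant C₁ > 1 independent of n such that C₁^{−1} n ≤ a_n Q'(a_n) ≤ C₁ n for all n ≥ 1. -/
open MeasureTheory ProbabilityTheory Filter Set Topology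
open scoped ENNReal NNReal Classical

noncomputable section

/-- The class `F(C²)` of Levin–Lubinsky: conditions on `Q` (with derivative `Q'` and
second derivative `Q''` away from the origin) so that `W = e^{-Q} ∈ F(C²)`. -/
structure IsFC2 (Q Q' Q'' : ℝ → ℝ) : Prop where
  nonneg : ∀ x, 0 ≤ Q x
  hasDeriv : ∀ x, HasDerivAt Q (Q' x) x
  contDeriv : Continuous Q'
  zeroAtZero : Q 0 = 0
  monoDeriv : Monotone Q'
  hasDeriv2 : ∀ x ≠ 0, HasDerivAt Q' (Q'' x) x
  tendstoTop : Tendsto Q atTop atTop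
  tendstoBot : Tendsto Q atBot atTop
  quasiIncr : ∃ C > 0, ∀ x y : ℝ, 0 < x → x < y →
      x * Q' x / Q x ≤ C * (y * Q' y / Q y)
  quasiIncrNeg : ∃ C > 0, ∀ x y : ℝ, y < x → x < 0 →
      x * Q' x / Q x ≤ C * (y * Q' y / Q y)
  lambdaBound : ∃ Λ > 1, ∀ t : ℝ, t ≠ 0 → Λ ≤ t * Q' t / Q t
  derivRatio : ∃ C > 0, ∀ x : ℝ, x ≠ 0 → Q'' x / |Q' x| ≤ C * (|Q' x| / Q x)

/-- The Mhaskar–Rakhmanov–Saff numbers `a n > 0` for an even external field `Q`,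
defined by `(2/π) ∫₀¹ aₙ t Q'(aₙ t)/√(1-t²) dt = n`. -/
def IsMRSeven (Q' : ℝ → ℝ) (a : ℕ → ℝ) : Prop :=
  ∀ n : ℕ, 1 ≤ n → 0 < a n ∧
    (2 / Real.pi) * ∫ t in (0:ℝ)..1, a n * t * Q' (a n * t) / Real.sqrt (1 - t ^ 2)
      = (n : ℝ)

lemma aux_int : IntervalIntegrable (fun t : ℝ => 1 / Real.sqrt (1 - t ^ 2)) volume 0 1 := by
  apply intervalIntegral.intervalIntegrable_deriv_of_nonneg (g := Real.arcsin)
  · exact Real.continuous_arcsin.continuousOn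
  · intro x hx
    simp only [zero_le_one, min_eq_left, max_eq_right, mem_Ioo] at hx
    exact Real.hasDerivAt_arcsin (by linarith) (by linarith)
  · intro x hx
    positivity

lemma aux_val : ∫ t in (0:ℝ)..1, 1 / Real.sqrt (1 - t ^ 2) = Real.pi / 2 := by
  rw [intervalIntegral.integral_eq_sub_of_hasDerivAt_of_le (f := Real.arcsin) zero_le_one
    Real.continuous_arcsin.continuousOn _ aux_int]
  · simp
  · intro x hx
    exact Real.hasDerivAt_arcsin (by linarith [hx.1]) (by linarith [hx.2])

lemma aux_pos {Q Q' Q'' : ℝ → ℝ} (h : IsFC2 Q Q' Q'') {x : ℝ} (hx : 0 < x) :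
    0 < Q x ∧ 0 < Q' x := by
  obtain ⟨Λ, hΛ, hb⟩ := h.lambdaBound
  have h1 := hb x hx.ne'
  have h0 : 0 < x * Q' x / Q x := by linarith
  have hq : 0 < Q x := by
    rcases (h.nonneg x).lt_or_eq with h2 | h2
    · exact h2
    · rw [← h2] at h0; simp at h0
  refine ⟨hq, ?_⟩
  have h3 := (div_pos_iff_of_pos_right hq).1 h0
  exact (mul_pos_iff_of_pos_left hx).1 h3

lemma aux_Q {Q Q' Q'' : ℝ → ℝ} (h : IsFC2 Q Q' Q'') {α : ℝ}
    (hT : Tendsto (fun x : ℝ => x * Q' x / Q x) atTop (𝓝 α)) {t : ℝ} (ht0 : 0 < t)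
    (ht1 : t < 1) :
    Tendsto (fun a : ℝ => Q (a * t) / Q a) atTop (𝓝 (t ^ α)) := by
  have key : ∀ a : ℝ, ∃ c, 0 < a → (a * t < c ∧
      Real.log t * (c * Q' c / Q c) = Real.log (Q (a * t) / Q a)) := by
    intro a
    by_cases ha : 0 < a
    swap
    · exact ⟨0, fun h => absurd h ha⟩
    have hat : 0 < a * t := mul_pos ha ht0
    have hlt : a * t < a := by nlinarith
    obtain ⟨c, hc, he⟩ := exists_ratio_hasDerivAt_eq_ratio_slope
      (fun x => Real.log (Q x)) (fun x => Q' x / Q x) hlt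
      (fun x hx => ((h.hasDeriv x).log
        (aux_pos h (hat.trans_le hx.1)).1.ne').continuousAt.continuousWithinAt)
      (fun x hx => (h.hasDeriv x).log (aux_pos h (hat.trans hx.1)).1.ne')
      Real.log (fun x => x⁻¹)
      (fun x hx => (Real.hasDerivAt_log (hat.trans_le hx.1).ne').continuousAt.continuousWithinAt)
      (fun x hx => Real.hasDerivAt_log (hat.trans hx.1).ne')
    refine ⟨c, fun _ => ⟨hc.1, ?_⟩⟩
    have hc0 : 0 < c := hat.trans hc.1
    have hQc := (aux_pos h hc0).1
    rw [Real.log_div (aux_pos h hat).1.ne' (aux_pos h ha).1.ne']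
    rw [Real.log_mul ha.ne' ht0.ne'] at he
    field_simp at he ⊢
    linarith
  choose c hc using key
  have hct : Tendsto c atTop atTop := by
    refine tendsto_atTop_mono' _ ?_ (tendsto_id.atTop_mul_const ht0)
    filter_upwards [eventually_gt_atTop 0] with a ha
    exact (hc a ha).1.le
  have h1 : Tendsto (fun a => Real.exp (Real.log t * (c a * Q' (c a) / Q (c a)))) atTop
      (𝓝 (Real.exp (Real.log t * α))) :=
    (Real.continuous_exp.tendsto _).comp ((hT.comp hct).const_mul (Real.log t))
  rw [Real.rpow_def_of_pos ht0]
  refine h1.congr' ?_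
  filter_upwards [eventually_gt_atTop 0] with a ha
  rw [(hc a ha).2, Real.exp_log]
  exact div_pos (aux_pos h (mul_pos ha ht0)).1 (aux_pos h ha).1

lemma aux_f {Q Q' Q'' : ℝ → ℝ} (h : IsFC2 Q Q' Q'') {α : ℝ} (hα : 1 < α)
    (hT : Tendsto (fun x : ℝ => x * Q' x / Q x) atTop (𝓝 α)) {t : ℝ} (ht0 : 0 < t)
    (ht1 : t < 1) :
    Tendsto (fun a : ℝ => (a * t * Q' (a * t)) / (a * Q' a)) atTop (𝓝 (t ^ α)) := by
  have h1 := (((hT.comp (tendsto_id.atTop_mul_const ht0)).div hT (by linarith)).mul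
    (aux_Q h hT ht0 ht1))
  rw [div_self (by linarith), one_mul] at h1
  refine h1.congr' ?_
  filter_upwards [eventually_gt_atTop 0] with a ha
  have hat : 0 < a * t := mul_pos ha ht0
  obtain ⟨p1, p2⟩ := aux_pos h ha
  obtain ⟨p3, p4⟩ := aux_pos h hat
  simp only [Function.comp, id, Pi.div_apply]
  field_simp

lemma aux_le {Q Q' Q'' : ℝ → ℝ} (h : IsFC2 Q Q' Q'') {x y : ℝ} (hx : 0 < x) (hxy : x ≤ y) :
    x * Q' x ≤ y * Q' y :=
  mul_le_mul hxy (h.monoDeriv hxy) (aux_pos h hx).2.le (hx.le.trans hxy)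

lemma aux_meas {Q Q' Q'' : ℝ → ℝ} (h : IsFC2 Q Q' Q'') (a : ℝ) :
    Measurable (fun t : ℝ => a * t * Q' (a * t) / Real.sqrt (1 - t ^ 2)) := by
  have := h.contDeriv
  apply Measurable.div
  · exact (by fun_prop : Continuous fun t : ℝ => a * t * Q' (a * t)).measurable
  · exact (by fun_prop : Continuous fun t : ℝ => Real.sqrt (1 - t ^ 2)).measurable

lemma aux_bound {Q Q' Q'' : ℝ → ℝ} (h : IsFC2 Q Q' Q'') {a t : ℝ} (ha : 0 < a)
    (ht : t ∈ Set.uIoc (0:ℝ) 1) :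
    ‖a * t * Q' (a * t) / Real.sqrt (1 - t ^ 2)‖ ≤ (a * Q' a) * (1 / Real.sqrt (1 - t ^ 2)) := by
  rw [uIoc_of_le zero_le_one] at ht
  have hat : 0 < a * t := mul_pos ha ht.1
  have h1 := (aux_pos h hat).2
  have h2 := aux_le h hat (by nlinarith [ht.2] : a * t ≤ a)
  rw [Real.norm_of_nonneg (by positivity), mul_one_div]
  gcongr

lemma aux_lower {Q Q' Q'' : ℝ → ℝ} (h : IsFC2 Q Q' Q'') {an : ℕ → ℝ} (han : IsMRSeven Q' an)
    {n : ℕ} (hn : 1 ≤ n) : (n : ℝ) ≤ an n * Q' (an n) := by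
  obtain ⟨ha, he⟩ := han n hn
  have hi := aux_int.const_mul (an n * Q' (an n))
  have h1 : ∫ t in (0:ℝ)..1, an n * t * Q' (an n * t) / Real.sqrt (1 - t ^ 2)
      ≤ ∫ t in (0:ℝ)..1, (an n * Q' (an n)) * (1 / Real.sqrt (1 - t ^ 2)) := by
    have hb : IntervalIntegrable
        (fun t => an n * t * Q' (an n * t) / Real.sqrt (1 - t ^ 2)) volume 0 1 := by
      refine hi.mono_fun' (aux_meas h _).aestronglyMeasurable ?_
      refine (ae_restrict_iff' measurableSet_uIoc).2 (Eventually.of_forall fun t ht => ?_)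
      exact aux_bound h ha ht
    refine intervalIntegral.integral_mono_on_of_le_Ioo zero_le_one hb hi ?_
    intro t ht
    refine (le_abs_self _).trans (aux_bound h ha ?_)
    rw [uIoc_of_le zero_le_one]
    exact ⟨ht.1, ht.2.le⟩
  rw [intervalIntegral.integral_const_mul, aux_val] at h1
  have hpi := Real.pi_pos
  calc (n : ℝ) = _ := he.symm
    _ ≤ (2 / Real.pi) * (an n * Q' (an n) * (Real.pi / 2)) := by gcongr
    _ = an n * Q' (an n) := by field_simp

lemma aux_an {Q Q' Q'' : ℝ → ℝ} (h : IsFC2 Q Q' Q'') {an : ℕ → ℝ} (han : IsMRSeven Q' an) :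
    Tendsto an atTop atTop := by
  refine tendsto_atTop.2 fun M => ?_
  filter_upwards [eventually_ge_atTop 1,
    tendsto_natCast_atTop_atTop.eventually_gt_atTop (M * Q' M)] with n hn hM
  by_contra hlt
  push Not at hlt
  have := aux_le h (han n hn).1 hlt.le
  have := aux_lower h han hn
  linarith

lemma aux_Bpos {α : ℝ} (hα : 1 < α) :
    0 < (2 / Real.pi) * ∫ t in (0:ℝ)..1, t ^ α / Real.sqrt (1 - t ^ 2) := by
  have hpi := Real.pi_pos
  refine mul_pos (by positivity) ?_
  refine intervalIntegral.intervalIntegral_pos_of_pos_on ?_ ?_ zero_lt_one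
  · refine aux_int.mono_fun' ?_ ?_
    · have h1 : Continuous fun t : ℝ => t ^ α := Real.continuous_rpow_const (by linarith)
      have h2 : Continuous fun t : ℝ => Real.sqrt (1 - t ^ 2) := by fun_prop
      exact (h1.measurable.div h2.measurable).aestronglyMeasurable
    · refine (ae_restrict_iff' measurableSet_uIoc).2 (Eventually.of_forall fun t ht => ?_)
      rw [uIoc_of_le zero_le_one] at ht
      have := ht.1
      have h1 : t ^ α ≤ 1 := Real.rpow_le_one ht.1.le ht.2 (by linarith)
      beta_reduce
      rw [Real.norm_of_nonneg (by positivity)]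
      gcongr
  · intro t ht
    have h1 := ht.1
    have h2 : 0 < 1 - t ^ 2 := by nlinarith [ht.2]
    positivity

lemma aux_lim {Q Q' Q'' : ℝ → ℝ} (h : IsFC2 Q Q' Q'') {α : ℝ} (hα : 1 < α)
    (hT : Tendsto (fun x : ℝ => x * Q' x / Q x) atTop (𝓝 α)) :
    Tendsto (fun a : ℝ => ∫ t in (0:ℝ)..1,
        (a * t * Q' (a * t) / Real.sqrt (1 - t ^ 2)) / (a * Q' a)) atTop
      (𝓝 (∫ t in (0:ℝ)..1, t ^ α / Real.sqrt (1 - t ^ 2))) := by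
  refine intervalIntegral.tendsto_integral_filter_of_dominated_convergence
    (fun t : ℝ => 1 / Real.sqrt (1 - t ^ 2)) ?_ ?_ aux_int ?_
  · exact Eventually.of_forall fun a => ((aux_meas h a).div_const _).aestronglyMeasurable
  · filter_upwards [eventually_gt_atTop 0] with a ha
    refine Eventually.of_forall fun t ht => ?_
    have hp : 0 < a * Q' a := mul_pos ha (aux_pos h ha).2
    rw [norm_div, Real.norm_of_nonneg hp.le, div_le_iff₀ hp, mul_comm (1 / _)]
    exact aux_bound h ha ht
  · refine Eventually.of_forall fun t ht => ?_
    rw [uIoc_of_le zero_le_one] at ht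
    rcases ht.2.lt_or_eq with h1 | h1
    · refine ((aux_f h hα hT ht.1 h1).div_const _).congr fun a => ?_
      rw [div_right_comm]
    · subst h1
      simp

/-- Equation (3.7)–(3.8) in the proof of Lemma 3.2: for `W = e^{-Q} ∈ F(C²)` with `Q` even
and `T → α ∈ (1,∞)`, one has `lim n/(aₙ Q'(aₙ)) = B_α = (2/π)∫₀¹ t^α/√(1-t²) dt`;
in particular `C₁⁻¹ n ≤ aₙ Q'(aₙ) ≤ C₁ n` for all `n ≥ 1` and some constant `C₁ > 1`. -/
theorem statement_14
    (Q Q' Q'' W : ℝ → ℝ) (hW : ∀ x, W x = Real.exp (-Q x))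
    (hFC2 : IsFC2 Q Q' Q'')
    (hQeven : ∀ x, Q (-x) = Q x)
    (α : ℝ) (hα : 1 < α)
    (hT : Tendsto (fun x : ℝ => x * Q' x / Q x) atTop (𝓝 α))
    (an : ℕ → ℝ) (han : IsMRSeven Q' an) :
    Tendsto (fun n : ℕ => (n : ℝ) / (an n * Q' (an n))) atTop
        (𝓝 ((2 / Real.pi) * ∫ t in (0:ℝ)..1, t ^ α / Real.sqrt (1 - t ^ 2))) ∧
      ∃ C₁ : ℝ, 1 < C₁ ∧ ∀ n : ℕ, 1 ≤ n →
        C₁⁻¹ * n ≤ an n * Q' (an n) ∧ an n * Q' (an n) ≤ C₁ * n := by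
  have hlim : Tendsto (fun n : ℕ => (n : ℝ) / (an n * Q' (an n))) atTop
        (𝓝 ((2 / Real.pi) * ∫ t in (0:ℝ)..1, t ^ α / Real.sqrt (1 - t ^ 2))) := by
    refine (((aux_lim hFC2 hα hT).comp (aux_an hFC2 han)).const_mul (2 / Real.pi)).congr' ?_
    filter_upwards [eventually_ge_atTop 1] with n hn
    simp only [Function.comp]
    rw [intervalIntegral.integral_div, ← mul_div_assoc, (han n hn).2]
  refine ⟨hlim, ?_⟩
  obtain ⟨M, hM⟩ := (hlim.inv₀ (aux_Bpos hα).ne').bddAbove_range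
  refine ⟨max M 2, lt_max_of_lt_right one_lt_two, fun n hn => ?_⟩
  have hn0 : (0 : ℝ) < n := by exact_mod_cast hn
  have hC : (2 : ℝ) ≤ max M 2 := le_max_right _ _
  constructor
  · refine le_trans ?_ (aux_lower hFC2 han hn)
    exact mul_le_of_le_one_left hn0.le (inv_le_one_of_one_le₀ (by linarith))
  · have h1 : ((n : ℝ) / (an n * Q' (an n)))⁻¹ ≤ M := hM ⟨n, rfl⟩
    rw [inv_div] at h1
    exact (div_le_iff₀ hn0).1 (h1.trans (le_max_left _ _))
end
end

section
/- For every α ∈ (0, ∞) and every x ∈ (−1,1) with x ≠ 0, the density of the Ullman distribution admits the alternative representation (α/π) ∫_{|x|}^1 t^{α−1}/√(t² − x²) dt = (2√(1 − x²)/(π² B_α)) ∫₀¹ ((t^α − |x|^α)/(t² − x²)) dt/√(1 − t²), where B_α = (2/π) ∫₀¹ t^α/√(1 − t²) dt. -/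
open MeasureTheory ProbabilityTheory Filter Set Topology
open scoped ENNReal NNReal Classical

noncomputable section

lemma aux_ftc {f f' : ℝ → ℝ} {a b : ℝ} (hab : a ≤ b) (hc : ContinuousOn f (Icc a b))
    (hd : ∀ t ∈ Ioo a b, HasDerivAt f (f' t) t) (hn : ∀ t ∈ Ioo a b, 0 ≤ f' t) :
    IntegrableOn f' (Ioo a b) ∧
    ∫⁻ t in Ioo a b, ENNReal.ofReal (f' t) = ENNReal.ofReal (f b - f a) := by
  have hi : IntegrableOn f' (Ioc a b) :=
    intervalIntegral.integrableOn_deriv_of_nonneg hc hd hn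
  have hi2 : IntervalIntegrable f' volume a b :=
    (intervalIntegrable_iff_integrableOn_Ioc_of_le hab).2 hi
  have h1 := intervalIntegral.integral_eq_sub_of_hasDerivAt_of_le hab hc hd hi2
  have hi3 : IntegrableOn f' (Ioo a b) := hi.mono_set Ioo_subset_Ioc_self
  refine ⟨hi3, ?_⟩
  rw [← h1, intervalIntegral.integral_of_le hab, integral_Ioc_eq_integral_Ioo,
    ofReal_integral_eq_lintegral_ofReal hi3]
  exact (ae_restrict_iff' measurableSet_Ioo).2 (ae_of_all _ hn)

def auxL (y s : ℝ) : ℝ :=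
  Real.log (y * √(1 - s ^ 2) + s * √(1 - y ^ 2)) - Real.log |y ^ 2 - s ^ 2| / 2

lemma aux_A {y s : ℝ} (hy : 0 < y) (hy1 : y < 1) (hs : 0 < s) (hs1 : s < 1) (hne : s ≠ y) :
    ∫⁻ r in Ioo (max s y) 1, ENNReal.ofReal (1 / (r * √(r ^ 2 - s ^ 2) * √(r ^ 2 - y ^ 2)))
      = ENNReal.ofReal (auxL y s / (s * y)) := by
  have hm : max s y ≤ 1 := max_le hs1.le hy1.le
  have hpos : ∀ t ∈ Icc (max s y) 1, 0 < y * √(t ^ 2 - s ^ 2) + s * √(t ^ 2 - y ^ 2) := by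
    intro t ht
    have h1 : s ≤ t := (le_max_left _ _).trans ht.1
    have h2 : y ≤ t := (le_max_right _ _).trans ht.1
    rcases lt_or_gt_of_ne hne with h | h
    · have : 0 < √(t ^ 2 - s ^ 2) := Real.sqrt_pos.2 (by nlinarith)
      positivity
    · have : 0 < √(t ^ 2 - y ^ 2) := Real.sqrt_pos.2 (by nlinarith)
      positivity
  have key := (aux_ftc (f := fun r => (Real.log (y * √(r ^ 2 - s ^ 2) + s * √(r ^ 2 - y ^ 2))
      - Real.log r) / (s * y))
      (f' := fun r => 1 / (r * √(r ^ 2 - s ^ 2) * √(r ^ 2 - y ^ 2))) hm ?_ ?_ ?_).2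
  · rw [key]
    congr 1
    have e : Real.log (y * √((max s y) ^ 2 - s ^ 2) + s * √((max s y) ^ 2 - y ^ 2))
        - Real.log (max s y) = Real.log |y ^ 2 - s ^ 2| / 2 := by
      rcases lt_or_gt_of_ne hne with h | h
      · have h3 : 0 < y ^ 2 - s ^ 2 := by nlinarith
        rw [max_eq_right h.le, abs_of_pos h3, ← Real.log_sqrt h3.le]
        have : 0 < √(y ^ 2 - s ^ 2) := Real.sqrt_pos.2 h3
        simp only [sub_self, Real.sqrt_zero, mul_zero, add_zero]
        rw [Real.log_mul hy.ne' this.ne']; ring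
      · have h3 : 0 < s ^ 2 - y ^ 2 := by nlinarith
        rw [max_eq_left h.le, abs_sub_comm, abs_of_pos h3, ← Real.log_sqrt h3.le]
        have : 0 < √(s ^ 2 - y ^ 2) := Real.sqrt_pos.2 h3
        simp only [sub_self, Real.sqrt_zero, mul_zero, zero_add]
        rw [Real.log_mul hs.ne' this.ne']; ring
    simp only [e, auxL, one_pow, Real.log_one]
    ring
  · apply ContinuousOn.div_const
    apply ContinuousOn.sub
    · apply ContinuousOn.log
      · fun_prop
      · intro t ht; exact (hpos t ht).ne'
    · apply ContinuousOn.log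
      · fun_prop
      · intro t ht; exact (lt_of_lt_of_le hs ((le_max_left _ _).trans ht.1)).ne'
  · intro t ht
    have h1 : s < t := (le_max_left _ _).trans_lt ht.1
    have h2 : y < t := (le_max_right _ _).trans_lt ht.1
    have ht0 : 0 < t := hs.trans h1
    have hA : 0 < t ^ 2 - s ^ 2 := by nlinarith
    have hB : 0 < t ^ 2 - y ^ 2 := by nlinarith
    have hA' := Real.sqrt_pos.2 hA
    have hB' := Real.sqrt_pos.2 hB
    have d1 : HasDerivAt (fun r : ℝ => √(r ^ 2 - s ^ 2)) ((2 * t) / (2 * √(t ^ 2 - s ^ 2))) t := by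
      have := (((hasDerivAt_id t).pow 2).sub_const (s ^ 2)).sqrt hA.ne'
      simpa using this
    have d2 : HasDerivAt (fun r : ℝ => √(r ^ 2 - y ^ 2)) ((2 * t) / (2 * √(t ^ 2 - y ^ 2))) t := by
      have := (((hasDerivAt_id t).pow 2).sub_const (y ^ 2)).sqrt hB.ne'
      simpa using this
    have hp := hpos t ⟨ht.1.le, ht.2.le⟩
    have d3 := ((((d1.const_mul y).add (d2.const_mul s)).log hp.ne').sub
      (Real.hasDerivAt_log ht0.ne')).div_const (s * y)
    simp only [Pi.add_apply] at d3
    refine d3.congr_deriv ?_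
    have qA := Real.sq_sqrt hA.le
    have qB := Real.sq_sqrt hB.le
    set A := √(t ^ 2 - s ^ 2)
    set B := √(t ^ 2 - y ^ 2)
    clear d3
    clear_value A B
    field_simp
    linear_combination (-y * B) * qA - s * A * qB
  · intro t ht
    have h1 : s < t := (le_max_left _ _).trans_lt ht.1
    have ht0 : 0 < t := hs.trans h1
    positivity

/-- derivative of the second primitive -/
lemma aux_Bd {y t : ℝ} (hy : 0 < y) (hy1 : y < 1) (ht : 0 < t) (ht1 : t < 1) (hne : t ≠ y) :
    HasDerivAt (fun t => (Real.log (y * √(1 - t ^ 2) + t * √(1 - y ^ 2)) -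
      Real.log (y ^ 2 - t ^ 2) / 2) / (y * √(1 - y ^ 2)))
      (1 / ((y ^ 2 - t ^ 2) * √(1 - t ^ 2))) t := by
  have hA : 0 < 1 - t ^ 2 := by nlinarith
  have hB : 0 < 1 - y ^ 2 := by nlinarith
  have hA' := Real.sqrt_pos.2 hA
  have hB' := Real.sqrt_pos.2 hB
  have hn : y ^ 2 - t ^ 2 ≠ 0 := by
    intro h
    have : (y - t) * (y + t) = 0 := by linarith
    rcases mul_eq_zero.1 this with h | h
    · exact hne (by linarith)
    · linarith
  have d1 : HasDerivAt (fun r : ℝ => √(1 - r ^ 2)) (-(2 * t) / (2 * √(1 - t ^ 2))) t := by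
    have := (((hasDerivAt_id t).pow 2).const_sub 1).sqrt hA.ne'
    simpa using this
  have d2 : HasDerivAt (fun r : ℝ => y ^ 2 - r ^ 2) (-(2 * t)) t := by
    have := (((hasDerivAt_id t).pow 2).const_sub (y ^ 2))
    simpa using this
  have hp : 0 < y * √(1 - t ^ 2) + t * √(1 - y ^ 2) := by positivity
  have d3 := ((((d1.const_mul y).add ((hasDerivAt_id t).mul_const (√(1 - y ^ 2)))).log
    (by simpa using hp.ne')).sub
      ((d2.log hn).div_const 2)).div_const (y * √(1 - y ^ 2))
  simp only [Pi.add_apply, id] at d3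
  refine d3.congr_deriv ?_
  have qA := Real.sq_sqrt hA.le
  have qB := Real.sq_sqrt hB.le
  set A := √(1 - t ^ 2)
  set B := √(1 - y ^ 2)
  clear d3
  clear_value A B
  field_simp
  linear_combination y * t * qA - y * t * qB

lemma aux_B1 {y s : ℝ} (hy : 0 < y) (hy1 : y < 1) (hs : 0 < s) (h : s < y) :
    ∫⁻ t in Ioo 0 s, ENNReal.ofReal (1 / (|t ^ 2 - y ^ 2| * √(1 - t ^ 2)))
      = ENNReal.ofReal (auxL y s / (y * √(1 - y ^ 2))) := by
  have key := (aux_ftc (f := fun t => (Real.log (y * √(1 - t ^ 2) + t * √(1 - y ^ 2)) -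
      Real.log (y ^ 2 - t ^ 2) / 2) / (y * √(1 - y ^ 2)))
      (f' := fun t => 1 / ((y ^ 2 - t ^ 2) * √(1 - t ^ 2))) hs.le ?_ ?_ ?_).2
  · rw [show auxL y s / (y * √(1 - y ^ 2)) = _ - _ from ?_, ← key]
    · refine setLIntegral_congr_fun measurableSet_Ioo fun t ht => ?_
      rw [abs_sub_comm, abs_of_pos (by nlinarith [ht.1, ht.2])]
    · have : 0 < y ^ 2 - s ^ 2 := by nlinarith
      simp [auxL, abs_of_pos this]
  · apply ContinuousOn.div_const
    apply ContinuousOn.sub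
    · apply ContinuousOn.log
      · fun_prop
      · intro t ht
        have : 0 < √(1 - t ^ 2) := Real.sqrt_pos.2 (by nlinarith [ht.1, ht.2])
        have := ht.1
        positivity
    · apply ContinuousOn.div_const
      apply ContinuousOn.log
      · fun_prop
      · intro t ht
        have : 0 < y ^ 2 - t ^ 2 := by nlinarith [ht.1, ht.2]
        exact this.ne'
  · intro t ht
    exact aux_Bd hy hy1 ht.1 (by linarith [ht.2]) (by linarith [ht.2])
  · intro t ht
    have : 0 < y ^ 2 - t ^ 2 := by nlinarith [ht.1, ht.2]
    positivity

lemma aux_B2 {y s : ℝ} (hy : 0 < y) (hs1 : s < 1) (h : y < s) :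
    ∫⁻ t in Ioo s 1, ENNReal.ofReal (1 / (|t ^ 2 - y ^ 2| * √(1 - t ^ 2)))
      = ENNReal.ofReal (auxL y s / (y * √(1 - y ^ 2))) := by
  have hy1 : y < 1 := h.trans hs1
  have hB' : 0 < √(1 - y ^ 2) := Real.sqrt_pos.2 (by nlinarith)
  have key := (aux_ftc (f := fun t => -((Real.log (y * √(1 - t ^ 2) + t * √(1 - y ^ 2)) -
      Real.log (y ^ 2 - t ^ 2) / 2) / (y * √(1 - y ^ 2))))
      (f' := fun t => -(1 / ((y ^ 2 - t ^ 2) * √(1 - t ^ 2)))) hs1.le ?_ ?_ ?_).2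
  · rw [show auxL y s / (y * √(1 - y ^ 2)) = _ - _ from ?_, ← key]
    · refine setLIntegral_congr_fun measurableSet_Ioo fun t ht => ?_
      rw [abs_of_pos (by nlinarith [ht.1, ht.2]), ← neg_sub (y ^ 2) (t ^ 2), neg_mul, div_neg]
    · have h2 : 0 < 1 - y ^ 2 := by nlinarith
      simp only [auxL, Real.log_abs, one_pow, sub_self, Real.sqrt_zero, mul_zero, zero_add, one_mul]
      rw [Real.log_sqrt h2.le, ← Real.log_neg_eq_log (1 - y ^ 2), neg_sub]
      ring
  · apply ContinuousOn.neg
    apply ContinuousOn.div_const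
    apply ContinuousOn.sub
    · apply ContinuousOn.log
      · fun_prop
      · intro t ht
        have : 0 < t := by linarith [ht.1]
        positivity
    · apply ContinuousOn.div_const
      apply ContinuousOn.log
      · fun_prop
      · intro t ht
        have : y ^ 2 - t ^ 2 < 0 := by nlinarith [ht.1, ht.2]
        exact this.ne
  · intro t ht
    exact (aux_Bd hy hy1 (by linarith [ht.1]) ht.2 (by linarith [ht.1])).neg
  · intro t ht
    have : 0 < t ^ 2 - y ^ 2 := by nlinarith [ht.1, ht.2]
    rw [← div_neg, ← neg_mul, neg_sub]
    positivity

lemma aux_ite {T U : Set ℝ} (hT : MeasurableSet T) (hU : MeasurableSet U) (P : ℝ → Prop)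
    [DecidablePred P] (f : ℝ → ℝ≥0∞) (hP : ∀ x ∈ T, (P x ↔ x ∈ U)) (hUT : U ⊆ T) :
    ∫⁻ x in T, (if P x then f x else 0) = ∫⁻ x in U, f x := by
  have : ∫⁻ x in T, (if P x then f x else 0) = ∫⁻ x in T, U.indicator f x := by
    refine setLIntegral_congr_fun hT fun x hx => ?_
    by_cases h : x ∈ U
    · simp [h, (hP x hx).2 h]
    · simp [h, mt (hP x hx).1 h]
  rw [this, setLIntegral_indicator hU, inter_eq_left.2 hUT]

lemma aux_scale {α r : ℝ} (hr : 0 < r) :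
    ∫⁻ s in Ioo 0 r, ENNReal.ofReal (s ^ α / √(r ^ 2 - s ^ 2)) =
      ENNReal.ofReal (r ^ α) * ∫⁻ t in Ioo (0:ℝ) 1, ENNReal.ofReal (t ^ α / √(1 - t ^ 2)) := by
  have h := lintegral_image_eq_lintegral_abs_deriv_mul (s := Ioo (0:ℝ) 1) (f := fun x => r * x)
    (f' := fun _ => r) measurableSet_Ioo
    (fun x _ => by simpa using ((hasDerivAt_id x).const_mul r).hasDerivWithinAt)
    ((mul_right_injective₀ hr.ne').injOn)
    (fun s => ENNReal.ofReal (s ^ α / √(r ^ 2 - s ^ 2)))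
  rw [image_mul_left_Ioo hr, mul_zero, mul_one] at h
  rw [h, ← lintegral_const_mul' _ _ ENNReal.ofReal_ne_top]
  refine setLIntegral_congr_fun measurableSet_Ioo fun t ht => ?_
  rw [← ENNReal.ofReal_mul (abs_nonneg _), ← ENNReal.ofReal_mul (by positivity), abs_of_pos hr,
    Real.mul_rpow hr.le ht.1.le, show r ^ 2 - (r * t) ^ 2 = r ^ 2 * (1 - t ^ 2) by ring,
    Real.sqrt_mul (by positivity), Real.sqrt_sq hr.le]
  congr 1
  have : 0 < √(1 - t ^ 2) := Real.sqrt_pos.2 (by nlinarith [ht.1, ht.2])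
  field_simp

lemma aux_mainA {α y : ℝ} (hy : 0 < y) (hy1 : y < 1) :
    (∫⁻ t in Ioo (0:ℝ) 1, ENNReal.ofReal (t ^ α / √(1 - t ^ 2))) *
      (∫⁻ r in Ioo y 1, ENNReal.ofReal (r ^ (α - 1) / √(r ^ 2 - y ^ 2))) =
    ENNReal.ofReal (1 / y) * ∫⁻ s in Ioo (0:ℝ) 1, ENNReal.ofReal (s ^ (α - 1) * auxL y s) := by
  let K : ℝ → ℝ → ℝ≥0∞ := fun r s => if s < r then
    ENNReal.ofReal (s ^ α) * ENNReal.ofReal (1 / (r * √(r ^ 2 - s ^ 2) * √(r ^ 2 - y ^ 2))) else 0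
  have hK : Measurable (Function.uncurry K) := by
    refine Measurable.ite (measurableSet_lt measurable_snd measurable_fst) ?_ measurable_const
    fun_prop
  have hswap := lintegral_lintegral_swap (μ := volume.restrict (Ioo y 1))
    (ν := volume.restrict (Ioo (0:ℝ) 1)) (f := K) hK.aemeasurable
  have hL : (∫⁻ t in Ioo (0:ℝ) 1, ENNReal.ofReal (t ^ α / √(1 - t ^ 2))) *
      (∫⁻ r in Ioo y 1, ENNReal.ofReal (r ^ (α - 1) / √(r ^ 2 - y ^ 2))) =
      ∫⁻ r in Ioo y 1, ∫⁻ s in Ioo (0:ℝ) 1, K r s := by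
    rw [← lintegral_const_mul _ (by fun_prop)]
    refine setLIntegral_congr_fun measurableSet_Ioo fun r hr => ?_
    have hr0 : 0 < r := hy.trans hr.1
    dsimp only [K]
    rw [aux_ite measurableSet_Ioo (measurableSet_Ioo (a := 0) (b := r)) (fun s => s < r) _
      (fun s hs => ⟨fun h => ⟨hs.1, h⟩, fun h => h.2⟩)
      (Ioo_subset_Ioo_right hr.2.le)]
    have : ∀ s ∈ Ioo 0 r, ENNReal.ofReal (s ^ α) *
        ENNReal.ofReal (1 / (r * √(r ^ 2 - s ^ 2) * √(r ^ 2 - y ^ 2))) =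
        ENNReal.ofReal (1 / (r * √(r ^ 2 - y ^ 2))) * ENNReal.ofReal (s ^ α / √(r ^ 2 - s ^ 2)) := by
      intro s hs
      have := hs.1
      rw [← ENNReal.ofReal_mul (by positivity), ← ENNReal.ofReal_mul (by positivity)]
      congr 1
      simp only [div_eq_mul_inv, mul_inv]
      ring
    rw [setLIntegral_congr_fun measurableSet_Ioo this,
      lintegral_const_mul' _ _ ENNReal.ofReal_ne_top, aux_scale hr0, ← mul_assoc,
      ← ENNReal.ofReal_mul (by positivity), mul_comm]
    congr 2
    rw [Real.rpow_sub hr0, Real.rpow_one]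
    simp only [div_eq_mul_inv, mul_inv]
    ring
  rw [hL, hswap, ← lintegral_const_mul' _ _ ENNReal.ofReal_ne_top]
  refine setLIntegral_congr_fun_ae measurableSet_Ioo ?_
  filter_upwards [(measure_eq_zero_iff_ae_notMem.1 (measure_singleton (μ := volume) y))] with s hsy hs
  have hne : s ≠ y := by simpa using hsy
  have hs0 := hs.1
  dsimp only [K]
  rw [aux_ite measurableSet_Ioo (measurableSet_Ioo (a := max s y) (b := 1)) (fun r => s < r) _
      (fun r hr => ⟨fun h => ⟨max_lt h hr.1, hr.2⟩, fun h => (le_max_left _ _).trans_lt h.1⟩)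
      (Ioo_subset_Ioo_left (le_max_right _ _)), lintegral_const_mul' _ _ ENNReal.ofReal_ne_top,
      aux_A hy hy1 hs.1 hs.2 hne, ← ENNReal.ofReal_mul (by positivity),
      ← ENNReal.ofReal_mul (by positivity)]
  congr 1
  rw [Real.rpow_sub hs.1, Real.rpow_one]
  field_simp

lemma aux_pow {α a b : ℝ} (hα : 0 < α) (ha : 0 < a) (hab : a ≤ b) :
    ∫⁻ s in Ioo a b, ENNReal.ofReal (α * s ^ (α - 1)) = ENNReal.ofReal (b ^ α - a ^ α) := by
  refine (aux_ftc (f := fun s => s ^ α) (f' := fun s => α * s ^ (α - 1)) hab ?_ ?_ ?_).2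
  · intro t ht
    exact (Real.continuousAt_rpow_const _ _ (Or.inr hα.le)).continuousWithinAt
  · intro t ht
    exact Real.hasDerivAt_rpow_const (Or.inl (ha.trans ht.1).ne')
  · intro t ht
    have := ha.trans ht.1
    positivity

lemma aux_mainB {α y : ℝ} (hα : 0 < α) (hy : 0 < y) (hy1 : y < 1) :
    ∫⁻ t in Ioo (0:ℝ) 1, ENNReal.ofReal (((t ^ α - y ^ α) / (t ^ 2 - y ^ 2)) / √(1 - t ^ 2)) =
    ENNReal.ofReal (α / (y * √(1 - y ^ 2))) *
      ∫⁻ s in Ioo (0:ℝ) 1, ENNReal.ofReal (s ^ (α - 1) * auxL y s) := by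
  let K : ℝ → ℝ → ℝ≥0∞ := fun t s => if (min t y < s ∧ s < max t y) then
    ENNReal.ofReal (α * s ^ (α - 1)) * ENNReal.ofReal (1 / (|t ^ 2 - y ^ 2| * √(1 - t ^ 2))) else 0
  have hK : Measurable (Function.uncurry K) := by
    refine Measurable.ite ?_ ?_ measurable_const
    · exact (measurableSet_lt (measurable_fst.min measurable_const) measurable_snd).inter
        (measurableSet_lt measurable_snd (measurable_fst.max measurable_const))
    · fun_prop
  have hswap := lintegral_lintegral_swap (μ := volume.restrict (Ioo (0:ℝ) 1))
    (ν := volume.restrict (Ioo (0:ℝ) 1)) (f := K) hK.aemeasurable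
  have hB' : 0 < √(1 - y ^ 2) := Real.sqrt_pos.2 (by nlinarith)
  have hL : ∫⁻ t in Ioo (0:ℝ) 1,
      ENNReal.ofReal (((t ^ α - y ^ α) / (t ^ 2 - y ^ 2)) / √(1 - t ^ 2)) =
      ∫⁻ t in Ioo (0:ℝ) 1, ∫⁻ s in Ioo (0:ℝ) 1, K t s := by
    refine setLIntegral_congr_fun measurableSet_Ioo fun t ht => ?_
    have ht0 := ht.1
    have hmin : 0 < min t y := lt_min ht.1 hy
    dsimp only [K]
    rw [aux_ite measurableSet_Ioo (measurableSet_Ioo (a := min t y) (b := max t y))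
      (fun s => min t y < s ∧ s < max t y) _ (fun s hs => Iff.rfl)
      (Ioo_subset_Ioo hmin.le (max_lt ht.2 hy1).le),
      lintegral_mul_const' _ _ ENNReal.ofReal_ne_top, aux_pow hα hmin min_le_max]
    rcases le_total t y with h | h
    · have h1 : t ^ α ≤ y ^ α := Real.rpow_le_rpow ht.1.le h hα.le
      rw [min_eq_left h, max_eq_right h, ← ENNReal.ofReal_mul (by linarith), abs_sub_comm,
        abs_of_nonneg (by nlinarith), ← neg_sub (y ^ α), ← neg_sub (y ^ 2), neg_div_neg_eq,
        mul_one_div, div_div]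
    · have h1 : y ^ α ≤ t ^ α := Real.rpow_le_rpow hy.le h hα.le
      rw [min_eq_right h, max_eq_left h, ← ENNReal.ofReal_mul (by linarith),
        abs_of_nonneg (by nlinarith), mul_one_div, div_div]
  rw [hL, hswap, ← lintegral_const_mul' _ _ ENNReal.ofReal_ne_top]
  refine setLIntegral_congr_fun_ae measurableSet_Ioo ?_
  filter_upwards [(measure_eq_zero_iff_ae_notMem.1 (measure_singleton (μ := volume) y))] with s hsy hs
  have hne : s ≠ y := by simpa using hsy
  have hs0 := hs.1
  have fin : ENNReal.ofReal (α * s ^ (α - 1)) * ENNReal.ofReal (auxL y s / (y * √(1 - y ^ 2))) =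
      ENNReal.ofReal (α / (y * √(1 - y ^ 2))) * ENNReal.ofReal (s ^ (α - 1) * auxL y s) := by
    rw [← ENNReal.ofReal_mul (by positivity), ← ENNReal.ofReal_mul (by positivity)]
    congr 1
    field_simp
  rw [← fin]
  dsimp only [K]
  rcases lt_or_gt_of_ne hne with h | h
  · rw [aux_ite measurableSet_Ioo (measurableSet_Ioo (a := 0) (b := s))
      (fun t => min t y < s ∧ s < max t y) _ ?_ (Ioo_subset_Ioo_right hs.2.le),
      lintegral_const_mul' _ _ ENNReal.ofReal_ne_top, aux_B1 hy hy1 hs.1 h]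
    intro t ht
    simp only [min_lt_iff, lt_max_iff, mem_Ioo]
    have := ht.1
    constructor
    · rintro ⟨h1 | h1, _⟩
      · exact ⟨this, h1⟩
      · linarith
    · rintro ⟨_, h1⟩
      exact ⟨Or.inl h1, Or.inr h⟩
  · rw [aux_ite measurableSet_Ioo (measurableSet_Ioo (a := s) (b := 1))
      (fun t => min t y < s ∧ s < max t y) _ ?_ (Ioo_subset_Ioo_left hs.1.le),
      lintegral_const_mul' _ _ ENNReal.ofReal_ne_top, aux_B2 hy hs.2 h]
    intro t ht
    simp only [min_lt_iff, lt_max_iff, mem_Ioo]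
    constructor
    · rintro ⟨_, h1 | h1⟩
      · exact ⟨h1, ht.2⟩
      · linarith
    · rintro ⟨h1, _⟩
      exact ⟨Or.inr h, Or.inl h1⟩

lemma aux_toL {f : ℝ → ℝ} {a b : ℝ} (hab : a ≤ b) (hf : Measurable f)
    (h0 : ∀ t ∈ Ioo a b, 0 ≤ f t) :
    ∫ t in a..b, f t = (∫⁻ t in Ioo a b, ENNReal.ofReal (f t)).toReal := by
  rw [intervalIntegral.integral_of_le hab, integral_Ioc_eq_integral_Ioo,
    integral_eq_lintegral_of_nonneg_ae _ hf.aestronglyMeasurable]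
  exact (ae_restrict_iff' measurableSet_Ioo).2 (ae_of_all _ h0)

lemma aux_I {α : ℝ} (hα : 0 < α) : 0 < ∫ t in (0:ℝ)..1, t ^ α / √(1 - t ^ 2) := by
  have h1 := (aux_ftc (f := Real.arcsin) (f' := fun t => 1 / √(1 - t ^ 2)) (zero_le_one' ℝ)
    Real.continuous_arcsin.continuousOn
    (fun t ht => Real.hasDerivAt_arcsin (by linarith [ht.1]) (by linarith [ht.2]))
    (fun t ht => by positivity)).1
  have h2 : IntegrableOn (fun t : ℝ => t ^ α / √(1 - t ^ 2)) (Ioo 0 1) := by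
    refine Integrable.mono h1 (Measurable.aestronglyMeasurable (by fun_prop)) ?_
    refine (ae_restrict_iff' measurableSet_Ioo).2 (ae_of_all _ fun t ht => ?_)
    have := ht.1
    rw [Real.norm_of_nonneg (by positivity), Real.norm_of_nonneg (by positivity)]
    gcongr
    exact Real.rpow_le_one ht.1.le ht.2.le hα.le
  refine intervalIntegral.intervalIntegral_pos_of_pos_on ?_ ?_ one_pos
  · rwa [intervalIntegrable_iff_integrableOn_Ioo_of_le zero_le_one]
  · intro t ht
    have := ht.1
    have : 0 < √(1 - t ^ 2) := Real.sqrt_pos.2 (by nlinarith [ht.1, ht.2])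
    positivity

/-- The alternative representation of the Ullman density: for `0 < α < ∞` and
`x ∈ (-1,1) \ {0}`,
`(α/π) ∫_{|x|}^1 t^{α-1}/√(t²-x²) dt
  = (2√(1-x²)/(π² B_α)) ∫₀¹ (t^α - |x|^α)/(t²-x²) · dt/√(1-t²)`,
where `B_α = (2/π) ∫₀¹ t^α/√(1-t²) dt`. -/
theorem statement_18
    (α : ℝ) (hα : 0 < α) (x : ℝ) (hx : x ∈ Set.Ioo (-1:ℝ) 1) (hx0 : x ≠ 0) :
    (α / Real.pi) * ∫ t in (|x|)..1, t ^ (α - 1) / Real.sqrt (t ^ 2 - x ^ 2)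
      = (2 * Real.sqrt (1 - x ^ 2) /
          (Real.pi ^ 2 * ((2 / Real.pi) * ∫ t in (0:ℝ)..1, t ^ α / Real.sqrt (1 - t ^ 2)))) *
        ∫ t in (0:ℝ)..1,
          ((t ^ α - |x| ^ α) / (t ^ 2 - x ^ 2)) / Real.sqrt (1 - t ^ 2) := by
  have hy : 0 < |x| := abs_pos.2 hx0
  have hy1 : |x| < 1 := abs_lt.2 hx
  rw [← sq_abs x]
  generalize |x| = y at hy hy1
  have hI := aux_I hα
  have eI := aux_toL (f := fun t => t ^ α / √(1 - t ^ 2)) (zero_le_one' ℝ) (by fun_prop)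
    (fun t ht => by have := ht.1; positivity)
  have eF := aux_toL (f := fun t => t ^ (α - 1) / √(t ^ 2 - y ^ 2)) hy1.le (by fun_prop)
    (fun t ht => by have := hy.trans ht.1; positivity)
  have eG := aux_toL (f := fun t => ((t ^ α - y ^ α) / (t ^ 2 - y ^ 2)) / √(1 - t ^ 2))
    (zero_le_one' ℝ) (by fun_prop) (fun t ht => by
      refine div_nonneg ?_ (Real.sqrt_nonneg _)
      rcases le_total t y with h | h
      · have h1 : t ^ α ≤ y ^ α := Real.rpow_le_rpow ht.1.le h hα.le
        exact div_nonneg_of_nonpos (by linarith) (by nlinarith [ht.1])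
      · have h1 : y ^ α ≤ t ^ α := Real.rpow_le_rpow hy.le h hα.le
        exact div_nonneg (by linarith) (by nlinarith [ht.1]))
  have mA := congrArg ENNReal.toReal (aux_mainA (α := α) hy hy1)
  have mB := congrArg ENNReal.toReal (aux_mainB hα hy hy1)
  have hB' : 0 < √(1 - y ^ 2) := Real.sqrt_pos.2 (by nlinarith)
  rw [ENNReal.toReal_mul, ENNReal.toReal_mul, ← eI, ← eF,
    ENNReal.toReal_ofReal (by positivity)] at mA
  rw [ENNReal.toReal_mul, ← eG, ENNReal.toReal_ofReal (by positivity)] at mB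
  rw [mB]
  generalize (∫⁻ s in Ioo (0:ℝ) 1, ENNReal.ofReal (s ^ (α - 1) * auxL y s)).toReal = J at mA
  generalize (∫ t in (0:ℝ)..1, t ^ α / √(1 - t ^ 2)) = I at mA hI
  generalize (∫ t in y..1, t ^ (α - 1) / √(t ^ 2 - y ^ 2)) = F at mA
  have hJ : J = y * (I * F) := by rw [mA]; field_simp
  have := Real.pi_pos
  rw [hJ]
  field_simp
end
end
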